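/- arXiv:2309.09967 — 4 statements merged into one kernel-verified Lean document; each statement's English description precedes it below -/
import Mathlib

section
/- Let N be a set of n = 2^{n'} players, v : N × N × ℕ → ℤ a game-value function, and V ∈ ℤ a target value. Define v' : N × N × ℕ → ℤ by v'(i,j,r) = max(v(i,j,r), v(j,i,r)). Then there exists a tournament seeding σ whose tournament value with respect to v is at least V if and only if there exists a tournament seeding σ' whose tournament value with respect to v' is at least V. -/
/-- Players are natural numbers; player `i` beats player `j` iff `i > j`.
Hence the winner of a (sub)tournament is its strongest player, i.e. the maximum
of the list of participating players. -/
def winner (l : List ℕ) : ℕ := l.foldr max 0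

/-- The tournament value of the seeding given by the list `l` of players in
seed-position order (`l.length = 2 ^ m`), with respect to the game-value
function `v`: the value of a tournament on a single player is `0`; otherwise it
is the value of the subtournament of the first half of the seed positions, plus
the value of the subtournament of the second half, plus `v i₁ i₂ m` where
`i₁, i₂` are the winners of the two halves playing each other in the final
round `m`. -/
def tourValue (v : ℕ → ℕ → ℕ → ℤ) : ℕ → List ℕ → ℤ
  | 0, _ => 0
  | m + 1, l =>
      tourValue v m (l.take (2 ^ m)) + tourValue v m (l.drop (2 ^ m)) +
        v (winner (l.take (2 ^ m))) (winner (l.drop (2 ^ m))) (m + 1)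

/-- `l` is a tournament seeding for the player set `N` iff `l` lists the
elements of `N`, each exactly once, in seed-position order. -/
def IsSeeding (N : Finset ℕ) (l : List ℕ) : Prop := l.Nodup ∧ l.toFinset = N

/-- The number of games won by player `i` in the tournament with `m` rounds on
the seeding `l`: in each (sub)tournament, the final game is won by the stronger
of the winners of the two halves. -/
def winCount (i : ℕ) : ℕ → List ℕ → ℕ
  | 0, _ => 0
  | m + 1, l =>
      winCount i m (l.take (2 ^ m)) + winCount i m (l.drop (2 ^ m)) +
        if i = max (winner (l.take (2 ^ m))) (winner (l.drop (2 ^ m))) then 1 else 0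

theorem winner_perm {l₁ l₂ : List ℕ} (h : l₁.Perm l₂) : winner l₁ = winner l₂ :=
  h.foldr_eq 0

theorem tourValue_mono {v w : ℕ → ℕ → ℕ → ℤ} (h : ∀ i j r, v i j r ≤ w i j r) (m : ℕ)
    (l : List ℕ) : tourValue v m l ≤ tourValue w m l := by
  induction m generalizing l with
  | zero => exact le_rfl
  | succ m ih => exact add_le_add (add_le_add (ih _) (ih _)) (h _ _ _)

theorem tourValue_succ_append (v : ℕ → ℕ → ℕ → ℤ) {m : ℕ} {a : List ℕ} (b : List ℕ)
    (ha : a.length = 2 ^ m) :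
    tourValue v (m + 1) (a ++ b) =
      tourValue v m a + tourValue v m b + v (winner a) (winner b) (m + 1) := by
  simp only [tourValue, List.take_left' ha, List.drop_left' ha]

/-- Swapping the two halves of suitable subtournaments realizes the symmetrized game values. -/
theorem exists_perm_tourValue_max_le (v : ℕ → ℕ → ℕ → ℤ) (m : ℕ) (l : List ℕ)
    (hl : l.length = 2 ^ m) :
    ∃ l' : List ℕ, l'.Perm l ∧
      tourValue (fun i j r => max (v i j r) (v j i r)) m l ≤ tourValue v m l' := by
  induction m generalizing l with
  | zero => exact ⟨l, .refl l, le_rfl⟩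
  | succ m ih =>
    obtain ⟨a, ha, hav⟩ := ih (l.take (2 ^ m)) (by rw [List.length_take, hl, pow_succ]; lia)
    obtain ⟨b, hb, hbv⟩ := ih (l.drop (2 ^ m)) (by rw [List.length_drop, hl, pow_succ]; lia)
    have hal : a.length = 2 ^ m := by rw [ha.length_eq, List.length_take, hl, pow_succ]; lia
    have hbl : b.length = 2 ^ m := by rw [hb.length_eq, List.length_drop, hl, pow_succ]; lia
    have hab : (a ++ b).Perm l := by simpa using ha.append hb
    rw [tourValue, ← winner_perm ha, ← winner_perm hb]
    rcases le_total (v (winner a) (winner b) (m + 1)) (v (winner b) (winner a) (m + 1))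
      with h | h
    · refine ⟨b ++ a, List.perm_append_comm.trans hab, ?_⟩
      rw [tourValue_succ_append v a hbl, max_eq_right h]
      lia
    · refine ⟨a ++ b, hab, ?_⟩
      rw [tourValue_succ_append v b hal, max_eq_left h]
      lia

/-- Replacing the game-value function `v` by
`v' i j r = max (v i j r) (v j i r)` does not change whether a tournament value
of at least `V` is achievable by some seeding. -/
theorem stmt_0 (N : Finset ℕ) (n' : ℕ) (hN : N.card = 2 ^ n')
    (v : ℕ → ℕ → ℕ → ℤ) (V : ℤ) :
    (∃ l : List ℕ, IsSeeding N l ∧ V ≤ tourValue v n' l) ↔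
      (∃ l : List ℕ, IsSeeding N l ∧
        V ≤ tourValue (fun i j r => max (v i j r) (v j i r)) n' l) := by
  constructor
  · rintro ⟨l, hl, hV⟩
    exact ⟨l, hl, hV.trans (tourValue_mono (fun _ _ _ => le_max_left _ _) n' l)⟩
  · rintro ⟨l, ⟨hnd, hlN⟩, hV⟩
    obtain ⟨l', hp, hle⟩ := exists_perm_tourValue_max_le v n' l
      (by rw [← List.toFinset_card_of_nodup hnd, hlN, hN])
    exact ⟨l', ⟨hp.nodup_iff.2 hnd, (List.toFinset_eq_of_perm _ _ hp).trans hlN⟩,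
      hV.trans hle⟩
end

section
/- Let φ be a (2,3)-CNF formula with n variables (each clause exactly two literals, each variable in at least 2 and at most 3 clauses), and let T_φ be the Tournament Value Maximization instance obtained from φ by Construction 1. If φ admits a truth assignment satisfying at least k clauses, then T_φ admits a tournament seeding whose tournament value is at least k + n. -/
/-- A clause with exactly two literals; a literal is a pair
(variable, polarity). -/
abbrev Clause2 := (ℕ × Bool) × (ℕ × Bool)

/-- The assignment `α` satisfies the clause `c` if it makes at least one of its
two literals true. -/
def clauseSat (α : ℕ → Bool) (c : Clause2) : Bool :=
  (α c.1.1 == c.1.2) || (α c.2.1 == c.2.2)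

/-- The number of clauses of `cs` satisfied by the assignment `α`. -/
def satCount (α : ℕ → Bool) (cs : List Clause2) : ℕ := cs.countP (clauseSat α)

/-- The list of all literal occurrences of the formula, in order. -/
def lits (cs : List Clause2) : List (ℕ × Bool) :=
  cs.foldr (fun c acc => c.1 :: c.2 :: acc) []

/-- `cs` is a (2,3)-CNF formula on the variables `1, …, n`: each clause has two
literals on two distinct variables from `{1, …, n}`, and each variable occurs
(equivalently, appears in) at least `2` and at most `3` clauses. -/
def Good23 (n : ℕ) (cs : List Clause2) : Prop :=
  (∀ c ∈ cs, 1 ≤ c.1.1 ∧ c.1.1 ≤ n ∧ 1 ≤ c.2.1 ∧ c.2.1 ≤ n ∧ c.1.1 ≠ c.2.1) ∧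
  (∀ x : ℕ, 1 ≤ x → x ≤ n →
      2 ≤ (lits cs).countP (fun p => p.1 == x) ∧
        (lits cs).countP (fun p => p.1 == x) ≤ 3)

/-- The total number of players `2 ^ n'`, where `n'` is the smallest integer
with `16 * n ≤ 2 ^ n'`.  The player set is `{0, 1, …, numP n - 1}` and the
`k`-th strongest player is the number `numP n - k`. -/
def numP (n : ℕ) : ℕ := 2 ^ Nat.clog 2 (16 * n)

/-- The variable player `x_i` (`i ∈ {1, …, n}`), of strength rank `3*i - 2`. -/
def xPl (n i : ℕ) : ℕ := numP n - (3 * i - 2)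

/-- The variable player `x_i^T`, of strength rank `3*i - 1`. -/
def xTPl (n i : ℕ) : ℕ := numP n - (3 * i - 1)

/-- The variable player `x_i^F`, of strength rank `3*i`. -/
def xFPl (n i : ℕ) : ℕ := numP n - (3 * i)

/-- The clause player `c_j` (`j ∈ {1, …, m}`), of strength rank `3*n + j`;
the remaining numbers are the dummy players `f_1, …, f_{13n+p-m}`. -/
def cPl (n j : ℕ) : ℕ := numP n - (3 * n + j)

/-- The variable player corresponding to a literal: `x_i^T` for a positive and
`x_i^F` for a negative occurrence of `x_i`. -/
def litPl (n : ℕ) (p : ℕ × Bool) : ℕ := if p.2 then xTPl n p.1 else xFPl n p.1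

/-- The games of value `1` of Construction 1 (before symmetrisation):
`v (x_i) (x_i^T) 1 = v (x_i) (x_i^F) 1 = 1`, and for the `t`-th literal
occurrence of the formula (belonging to clause number `t / 2 + 1`), on the
variable `x_i` with polarity `b`, being the `j`-th occurrence of `x_i` in the
formula, the game of `c_{t/2+1}` against `x_i^T` (if `b` is positive) resp.
`x_i^F` (if `b` is negative) in round `j` has value `1`. -/
def Gv1Core (n : ℕ) (cs : List Clause2) (a b r : ℕ) : Prop :=
  (∃ i : ℕ, 1 ≤ i ∧ i ≤ n ∧ a = xPl n i ∧ (b = xTPl n i ∨ b = xFPl n i) ∧ r = 1) ∨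
  (∃ t : ℕ, t < (lits cs).length ∧
      a = cPl n (t / 2 + 1) ∧ b = litPl n ((lits cs).getD t (0, true)) ∧
      r = 1 + ((lits cs).take t).countP
          (fun p => p.1 == ((lits cs).getD t (0, true)).1))

open Classical in
/-- The (symmetric) game-value function of Construction 1: value `1` for the
games described by `Gv1Core`, value `0` for all other games. -/
noncomputable def gv1 (n : ℕ) (cs : List Clause2) (a b r : ℕ) : ℤ :=
  if Gv1Core n cs a b r ∨ Gv1Core n cs b a r then 1 else 0

lemma winner_le {l : List ℕ} {b : ℕ} (h : ∀ a ∈ l, a ≤ b) : winner l ≤ b := by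
  induction l with
  | nil => exact Nat.zero_le b
  | cons a l ih =>
    exact max_le (h a (by simp)) (ih fun x hx => h x (by simp [hx]))

lemma winner_cons_of_forall_le {a : ℕ} {l : List ℕ} (h : ∀ b ∈ l, b ≤ a) :
    winner (a :: l) = a :=
  max_eq_left (winner_le h)

lemma gv1_nonneg (n : ℕ) (cs : List Clause2) (a b r : ℕ) : 0 ≤ gv1 n cs a b r := by
  unfold gv1; split_ifs <;> norm_num

section TourValue

variable {v : ℕ → ℕ → ℕ → ℤ}

lemma tourValue_nonneg (hv : ∀ a b r, 0 ≤ v a b r) (m : ℕ) (l : List ℕ) :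
    0 ≤ tourValue v m l := by
  induction m generalizing l with
  | zero => exact le_rfl
  | succ m ih => exact add_nonneg (add_nonneg (ih _) (ih _)) (hv _ _ _)

lemma tourValue_map_range'_succ (m s : ℕ) (g : ℕ → ℕ) :
    tourValue v (m + 1) ((List.range' s (2 ^ (m + 1))).map g) =
      tourValue v m ((List.range' s (2 ^ m)).map g) +
      tourValue v m ((List.range' (s + 2 ^ m) (2 ^ m)).map g) +
      v (winner ((List.range' s (2 ^ m)).map g))
        (winner ((List.range' (s + 2 ^ m) (2 ^ m)).map g)) (m + 1) := by
  have h : List.range' s (2 ^ (m + 1)) =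
      List.range' s (2 ^ m) ++ List.range' (s + 2 ^ m) (2 ^ m) := by
    rw [pow_succ, mul_two]
    simp
  rw [h, List.map_append, tourValue]
  have hl : ((List.range' s (2 ^ m)).map g).length = 2 ^ m := by simp
  rw [List.take_left' hl, List.drop_left' hl]

/-- A tournament is worth at least as much as all its subtournaments of `2 ^ d` players. -/
lemma sum_blocks_le_tourValue (hv : ∀ a b r, 0 ≤ v a b r) (d q s : ℕ) (g : ℕ → ℕ) :
    ∑ i ∈ Finset.range (2 ^ q), tourValue v d ((List.range' (s + 2 ^ d * i) (2 ^ d)).map g) ≤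
      tourValue v (d + q) ((List.range' s (2 ^ (d + q))).map g) := by
  induction q generalizing s with
  | zero => simp
  | succ q ih =>
    rw [← add_assoc, tourValue_map_range'_succ, pow_succ 2 q, mul_two, Finset.sum_range_add]
    have h1 := ih s
    have h2 := ih (s + 2 ^ (d + q))
    have h3 : ∀ i, s + 2 ^ d * (2 ^ q + i) = s + 2 ^ (d + q) + 2 ^ d * i := by
      intro i; ring
    simp only [h3]
    linarith [hv (winner ((List.range' s (2 ^ (d + q))).map g))
      (winner ((List.range' (s + 2 ^ (d + q)) (2 ^ (d + q))).map g)) (d + q + 1)]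

/-- In a subtournament of sixteen players, keep only the first game and the games on the
path of the player in position `8` up to the third round. -/
lemma games_le_tourValue_four (hv : ∀ a b r, 0 ≤ v a b r) (s : ℕ) (g : ℕ → ℕ)
    (h8 : ∀ r, 9 ≤ r → r < 16 → g (s + r) ≤ g (s + 8)) :
    v (g s) (g (s + 1)) 1 + v (g (s + 8)) (g (s + 9)) 1 +
      v (g (s + 8)) (winner [g (s + 10), g (s + 11)]) 2 +
      v (g (s + 8)) (winner [g (s + 12), g (s + 13), g (s + 14), g (s + 15)]) 3 ≤
    tourValue v 4 ((List.range' s (2 ^ 4)).map g) := by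
  have w1 : ∀ a, winner [a] = a := fun a => winner_cons_of_forall_le (by simp)
  have w2 : winner [g (s + 8), g (s + 9)] = g (s + 8) :=
    winner_cons_of_forall_le (by simpa using h8 9 (by norm_num) (by norm_num))
  have w3 : winner [g (s + 8), g (s + 9), g (s + 10), g (s + 11)] = g (s + 8) := by
    apply winner_cons_of_forall_le
    simp [h8]
  rw [tourValue_map_range'_succ 3, tourValue_map_range'_succ 2, tourValue_map_range'_succ 2,
    tourValue_map_range'_succ 1 s, tourValue_map_range'_succ 1 (s + 2 ^ 3),
    tourValue_map_range'_succ 0 s, tourValue_map_range'_succ 0 (s + 2 ^ 3)]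
  have w0 : ∀ l, tourValue v 0 l = 0 := fun _ => rfl
  simp only [w0, List.range', List.map, Nat.reducePow, Nat.reduceAdd, add_assoc,
    w1, w2, w3, zero_add]
  have hT := fun m l => tourValue_nonneg hv m l
  have t1 := hT 1 [g (s + 2), g (s + 3)]
  have t2 := hT 2 [g (s + 4), g (s + 5), g (s + 6), g (s + 7)]
  have t3 := hT 1 [g (s + 10), g (s + 11)]
  have t4 := hT 2 [g (s + 12), g (s + 13), g (s + 14), g (s + 15)]
  have t5 := hv (winner [g s, g (s + 1)]) (winner [g (s + 2), g (s + 3)]) 2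
  have t6 := hv (winner [g s, g (s + 1), g (s + 2), g (s + 3)])
    (winner [g (s + 4), g (s + 5), g (s + 6), g (s + 7)]) 3
  have t7 := hv (winner [g s, g (s + 1), g (s + 2), g (s + 3), g (s + 4), g (s + 5), g (s + 6),
    g (s + 7)]) (winner [g (s + 8), g (s + 9), g (s + 10), g (s + 11), g (s + 12), g (s + 13),
    g (s + 14), g (s + 15)]) 4
  linarith

end TourValue

section Formula

lemma length_lits (cs : List Clause2) : (lits cs).length = 2 * cs.length := by
  induction cs with
  | nil => rfl
  | cons c cs ih =>
    change (lits cs).length + 1 + 1 = 2 * (cs.length + 1)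
    omega

lemma lits_getD_two_mul (cs : List Clause2) (q : ℕ) (d : Clause2) (e : ℕ × Bool)
    (hq : q < cs.length) :
    (lits cs).getD (2 * q) e = (cs.getD q d).1 ∧
      (lits cs).getD (2 * q + 1) e = (cs.getD q d).2 := by
  induction cs generalizing q with
  | nil => simp at hq
  | cons c cs ih =>
    cases q with
    | zero => exact ⟨rfl, rfl⟩
    | succ q => exact ih q (by simpa using hq)

lemma fst_mem_of_mem_lits {n : ℕ} {cs : List Clause2} (h : Good23 n cs) {p : ℕ × Bool}
    (hp : p ∈ lits cs) : 1 ≤ p.1 ∧ p.1 ≤ n := by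
  have h1 := h.1
  clear h
  induction cs with
  | nil => simp [lits] at hp
  | cons c cs ih =>
    have hp' : p = c.1 ∨ p = c.2 ∨ p ∈ lits cs := by simpa [lits] using hp
    have hc := h1 c (by simp)
    rcases hp' with rfl | rfl | hp'
    · exact ⟨hc.1, hc.2.1⟩
    · exact ⟨hc.2.2.1, hc.2.2.2.1⟩
    · exact ih hp' fun c hc => h1 c (by simp [hc])

lemma length_le_sum_countP_fst {n : ℕ} (L : List (ℕ × Bool))
    (h : ∀ p ∈ L, 1 ≤ p.1 ∧ p.1 ≤ n) :
    L.length ≤ ∑ x ∈ Finset.Icc 1 n, L.countP (fun p => p.1 == x) := by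
  induction L with
  | nil => simp
  | cons p L ih =>
    have hp := h p (by simp)
    have := ih fun p hp => h p (by simp [hp])
    simp only [List.countP_cons, Finset.sum_add_distrib, List.length_cons]
    simp only [beq_iff_eq, Finset.sum_ite_eq, Finset.mem_Icc, hp, and_self, if_true]
    omega

lemma two_mul_length_le {n : ℕ} {cs : List Clause2} (h : Good23 n cs) :
    2 * cs.length ≤ 3 * n := by
  rw [← length_lits]
  refine (length_le_sum_countP_fst _ fun p hp => fst_mem_of_mem_lits h hp).trans ?_
  refine (Finset.sum_le_card_nsmul _ _ 3 fun x hx => ?_).trans (by simp [mul_comm])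
  rw [Finset.mem_Icc] at hx
  exact (h.2 x hx.1 hx.2).2

/-- Among the literals of `L`, the `t`-th one is occurrence number `occNum L t` of its variable. -/
def occNum (L : List (ℕ × Bool)) (t : ℕ) : ℕ :=
  1 + (L.take t).countP (fun p => p.1 == (L.getD t (0, true)).1)

lemma occNum_eq_countP_take_succ {L : List (ℕ × Bool)} {t : ℕ} (ht : t < L.length) :
    occNum L t = (L.take (t + 1)).countP (fun p => p.1 == (L.getD t (0, true)).1) := by
  rw [List.take_add_one, List.countP_append, occNum]
  simp [ht, add_comm]

lemma occNum_lt_occNum {L : List (ℕ × Bool)} {t u : ℕ} (htu : t < u) (hu : u < L.length)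
    (h : (L.getD t (0, true)).1 = (L.getD u (0, true)).1) : occNum L t < occNum L u := by
  rw [occNum_eq_countP_take_succ (htu.trans hu), h, occNum, Nat.lt_iff_add_one_le, add_comm 1]
  exact Nat.succ_le_succ (List.take_sublist_take_left htu).countP_le

lemma eq_of_occNum_eq {L : List (ℕ × Bool)} {t u : ℕ} (ht : t < L.length) (hu : u < L.length)
    (h : (L.getD t (0, true)).1 = (L.getD u (0, true)).1) (ho : occNum L t = occNum L u) :
    t = u := by
  rcases lt_trichotomy t u with hlt | heq | hlt
  · exact absurd ho (occNum_lt_occNum hlt hu h).ne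
  · exact heq
  · exact absurd ho (occNum_lt_occNum hlt ht h.symm).ne'

lemma occNum_le_three {n : ℕ} {cs : List Clause2} (h : Good23 n cs) {t : ℕ}
    (ht : t < (lits cs).length) : occNum (lits cs) t ≤ 3 := by
  rw [occNum_eq_countP_take_succ ht]
  have hm : (lits cs).getD t (0, true) ∈ lits cs := by
    rw [List.getD_eq_getElem _ _ ht]; exact List.getElem_mem ht
  have hx := fst_mem_of_mem_lits h hm
  exact (List.take_sublist _ _).countP_le.trans (h.2 _ hx.1 hx.2).2

lemma card_filter_range_getD {β : Type*} (p : β → Bool) (d : β) (l : List β) :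
    ((Finset.range l.length).filter fun q => p (l.getD q d) = true).card = l.countP p := by
  induction l with
  | nil => simp
  | cons a l ih =>
    rw [List.countP_cons, ← ih, Finset.card_filter, Finset.card_filter, List.length_cons,
      Finset.sum_range_succ']
    simp

/-- Each satisfied clause can be charged to the occurrence of a true literal in it. -/
lemma exists_true_occurrence (α : ℕ → Bool) (cs : List Clause2) :
    ∃ (Q : Finset ℕ) (τ : ℕ → ℕ), Q.card = satCount α cs ∧ ∀ q ∈ Q,
      q < cs.length ∧ τ q < (lits cs).length ∧ τ q / 2 = q ∧
      α ((lits cs).getD (τ q) (0, true)).1 = ((lits cs).getD (τ q) (0, true)).2 := by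
  classical
  let d : Clause2 := ((0, true), (0, true))
  refine ⟨(Finset.range cs.length).filter fun q => clauseSat α (cs.getD q d) = true,
    fun q => if α (cs.getD q d).1.1 = (cs.getD q d).1.2 then 2 * q else 2 * q + 1,
    card_filter_range_getD _ _ _, fun q hq => ?_⟩
  rw [Finset.mem_filter, Finset.mem_range] at hq
  obtain ⟨hq, hs⟩ := hq
  have hg := lits_getD_two_mul cs q d (0, true) hq
  have hl := length_lits cs
  simp only [clauseSat, Bool.or_eq_true, beq_iff_eq] at hs
  beta_reduce
  split_ifs with h
  · rw [hg.1]
    exact ⟨hq, by omega, by omega, h⟩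
  · rw [hg.2]
    exact ⟨hq, by omega, by omega, hs.resolve_left h⟩

end Formula

lemma le_numP (n : ℕ) : 16 * n ≤ numP n := Nat.le_pow_clog (by norm_num) _

open Classical in
/-- The prescribed part of the seeding: variable `i + 1` occupies the positions from `16 * i`
to `16 * i + 15`, and clause `q + 1` is met by variable `x q` in round `o q`. Positions that are
neither prescribed nor irrelevant receive the weakest players. -/
noncomputable def protoSeat (n : ℕ) (α : ℕ → Bool) (Q : Finset ℕ) (x o : ℕ → ℕ) (p : ℕ) : ℕ :=
  if p % 16 = 0 then xPl n (p / 16 + 1)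
  else if p % 16 = 1 then litPl n (p / 16 + 1, !α (p / 16 + 1))
  else if p % 16 = 8 then litPl n (p / 16 + 1, α (p / 16 + 1))
  else if h : ∃ q ∈ Q, x q = p / 16 + 1 ∧ 8 + 2 ^ (o q - 1) = p % 16 then cPl n (h.choose + 1)
  else 7 * (p / 16) + (p % 16 - 9)

section Seating

variable {n m : ℕ} {α : ℕ → Bool} {Q : Finset ℕ} {x o : ℕ → ℕ}

lemma protoSeat_cases (p : ℕ) :
    (p % 16 = 0 ∧ protoSeat n α Q x o p = xPl n (p / 16 + 1)) ∨
    (p % 16 = 1 ∧ protoSeat n α Q x o p = litPl n (p / 16 + 1, !α (p / 16 + 1))) ∨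
    (p % 16 = 8 ∧ protoSeat n α Q x o p = litPl n (p / 16 + 1, α (p / 16 + 1))) ∨
    (∃ q ∈ Q, x q = p / 16 + 1 ∧ 8 + 2 ^ (o q - 1) = p % 16 ∧
      protoSeat n α Q x o p = cPl n (q + 1)) ∨
    ((p % 16 ≠ 0 ∧ p % 16 ≠ 1 ∧ p % 16 ≠ 8) ∧
      (∀ q ∈ Q, x q = p / 16 + 1 → 8 + 2 ^ (o q - 1) ≠ p % 16) ∧
      protoSeat n α Q x o p = 7 * (p / 16) + (p % 16 - 9)) := by
  unfold protoSeat
  split_ifs with h0 h1 h8 h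
  · exact Or.inl ⟨h0, rfl⟩
  · exact Or.inr (Or.inl ⟨h1, rfl⟩)
  · exact Or.inr (Or.inr (Or.inl ⟨h8, rfl⟩))
  · exact Or.inr (Or.inr (Or.inr (Or.inl
      ⟨h.choose, h.choose_spec.1, h.choose_spec.2.1, h.choose_spec.2.2, rfl⟩)))
  · push Not at h
    exact Or.inr (Or.inr (Or.inr (Or.inr ⟨⟨h0, h1, h8⟩, h, rfl⟩)))

lemma litPl_eq (n i : ℕ) (b : Bool) :
    litPl n (i, b) = numP n - (3 * i - (if b then 1 else 0)) := by
  cases b <;> simp [litPl, xTPl, xFPl]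

lemma protoSeat_injOn (hm : m ≤ 5 * n) (hQ : ∀ q ∈ Q, q < m) :
    Set.InjOn (protoSeat n α Q x o)
      {p | p < 16 * n ∧ (p % 16 = 0 ∨ p % 16 = 1 ∨ 8 ≤ p % 16)} := by
  intro p hp p' hp' h
  have hN := le_numP n
  obtain ⟨hp, hr⟩ := hp
  obtain ⟨hp', hr'⟩ := hp'
  suffices hs : p / 16 = p' / 16 ∧ p % 16 = p' % 16 by omega
  have hlit : ∀ i : ℕ, ∃ a b, a + b = 1 ∧
      litPl n (i + 1, α (i + 1)) = numP n - (3 * (i + 1) - a) ∧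
      litPl n (i + 1, !α (i + 1)) = numP n - (3 * (i + 1) - b) := by
    intro i
    simp only [litPl_eq]
    cases α (i + 1)
    · exact ⟨0, 1, rfl, by simp, by simp⟩
    · exact ⟨1, 0, rfl, by simp, by simp⟩
  have hi : p / 16 < n := by omega
  have hi' : p' / 16 < n := by omega
  have hr16 : p % 16 < 16 := Nat.mod_lt _ (by norm_num)
  have hr16' : p' % 16 < 16 := Nat.mod_lt _ (by norm_num)
  have hc := protoSeat_cases (n := n) (α := α) (Q := Q) (x := x) (o := o) p
  have hc' := protoSeat_cases (n := n) (α := α) (Q := Q) (x := x) (o := o) p'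
  rw [← h] at hc'
  generalize protoSeat n α Q x o p = y at hc hc'
  clear h
  generalize p / 16 = i, p % 16 = r, p' / 16 = i', p' % 16 = r' at *
  clear hp hp'
  obtain ⟨a, b, hab, ha, hb⟩ := hlit i
  obtain ⟨a', b', hab', ha', hb'⟩ := hlit i'
  have hii : i = i' → a = a' := by
    clear hc hc'
    rintro rfl
    omega
  unfold xPl cPl at hc hc'
  rw [ha, hb] at hc
  rw [ha', hb'] at hc'
  clear ha hb ha' hb' hlit
  generalize numP n = N at *
  rcases hc with ⟨h, e⟩ | ⟨h, e⟩ | ⟨h, e⟩ | ⟨q, hq, hx, h, e⟩ | ⟨h, -, e⟩ <;>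
  rcases hc' with ⟨h', e'⟩ | ⟨h', e'⟩ | ⟨h', e'⟩ | ⟨q', hq', hx', h', e'⟩ | ⟨h', -, e'⟩ <;>
  (try have hqm := hQ _ hq) <;> (try have hqm' := hQ _ hq')
  case inr.inr.inr.inl.inr.inr.inr.inl =>
    obtain rfl : q = q' := by omega
    omega
  all_goals omega

/-- A partial injective placement of the players `0, …, N - 1` extends to a full one. -/
lemma exists_bijOn_extend {N : ℕ} {S : Set ℕ} {f : ℕ → ℕ} (hf : Set.InjOn f S)
    (hS : ∀ p ∈ S, p < N) (hfN : ∀ p ∈ S, f p < N) :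
    ∃ g : ℕ → ℕ, Set.BijOn g (Finset.range N) (Finset.range N) ∧ Set.EqOn g f S := by
  classical
  obtain ⟨e, he⟩ := Finset.exists_equiv_extend_of_card_eq (α := Fin N) (t := Finset.range N)
    (by simp) (s := Finset.univ.filter fun p : Fin N => (p : ℕ) ∈ S) (f := fun p => f p)
    (by
      intro y hy
      obtain ⟨p, hp, rfl⟩ := Finset.mem_image.1 hy
      exact Finset.mem_range.2 (hfN p (Finset.mem_filter.1 hp).2))
    (by
      intro p hp p' hp' h
      exact Fin.ext (hf (Finset.mem_filter.1 (Finset.mem_coe.1 hp)).2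
        (Finset.mem_filter.1 (Finset.mem_coe.1 hp')).2 h))
  refine ⟨fun p => if h : p < N then e ⟨p, h⟩ else 0, ⟨?_, ?_, ?_⟩, fun p hp => ?_⟩
  · intro p hp
    have hp : p < N := by simpa using hp
    simp only [hp, dif_pos]
    exact (e ⟨p, hp⟩).2
  · intro p hp p' hp' h
    have hp : p < N := by simpa using hp
    have hp' : p' < N := by simpa using hp'
    simp only [hp, hp', dif_pos] at h
    simpa using e.injective (Subtype.ext h)
  · intro y hy
    refine ⟨e.symm ⟨y, hy⟩, by simp, ?_⟩
    simp
  · have := he ⟨p, hS p hp⟩ (by simpa using hp)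
    simpa [hS p hp] using this

lemma isSeeding_map_range' {N : ℕ} {g : ℕ → ℕ}
    (hg : Set.BijOn g (Finset.range N) (Finset.range N)) :
    IsSeeding (Finset.range N) ((List.range' 0 N).map g) := by
  constructor
  · refine List.Nodup.map_on (fun a ha b hb h => hg.injOn ?_ ?_ h) List.nodup_range'
    · simpa using ha
    · simpa using hb
  · ext y
    have := Set.ext_iff.1 hg.image_eq y
    simpa using this

lemma two_pow_occ {j : ℕ} (h1 : 1 ≤ j) (h3 : j ≤ 3) :
    2 ^ (j - 1) = 1 ∨ 2 ^ (j - 1) = 2 ∨ 2 ^ (j - 1) = 4 := by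
  interval_cases j <;> simp

lemma two_pow_occ_inj {j k : ℕ} (hj : 1 ≤ j) (hk : 1 ≤ k) (h : 2 ^ (j - 1) = 2 ^ (k - 1)) :
    j = k := by
  have := Nat.pow_right_injective le_rfl h
  omega

lemma exists_seating (hm : m ≤ 5 * n) (hQ : ∀ q ∈ Q, q < m)
    (ho : ∀ q ∈ Q, 1 ≤ o q ∧ o q ≤ 3)
    (hxo : ∀ q ∈ Q, ∀ q' ∈ Q, x q = x q' → o q = o q' → q = q') :
    ∃ g : ℕ → ℕ, Set.BijOn g (Finset.range (numP n)) (Finset.range (numP n)) ∧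
      ∀ i < n, g (16 * i) = xPl n (i + 1) ∧ g (16 * i + 1) = litPl n (i + 1, !α (i + 1)) ∧
        g (16 * i + 8) = litPl n (i + 1, α (i + 1)) ∧
        (∀ q ∈ Q, x q = i + 1 → g (16 * i + (8 + 2 ^ (o q - 1))) = cPl n (q + 1)) ∧
        (∀ r, 9 ≤ r → r < 16 → g (16 * i + r) < numP n - 3 * n) ∧
        ∀ r, r = 11 ∨ 13 ≤ r ∧ r < 16 → g (16 * i + r) < 7 * n := by
  have hN := le_numP n
  have hcases := protoSeat_cases (n := n) (α := α) (Q := Q) (x := x) (o := o)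
  have hlit : ∀ i b, numP n - 3 * i ≤ litPl n (i, b) ∧ litPl n (i, b) ≤ numP n - (3 * i - 1) := by
    intro i b
    rw [litPl_eq]
    split_ifs <;> omega
  obtain ⟨g, hg, hgf⟩ := exists_bijOn_extend (N := numP n)
    (protoSeat_injOn (α := α) hm hQ) (fun p hp => hp.1.trans_le hN) (by
      rintro p ⟨hp, hr⟩
      rcases hcases p with ⟨h, e⟩ | ⟨h, e⟩ | ⟨h, e⟩ | ⟨q, hq, hxq, h, e⟩ | ⟨-, -, e⟩ <;> rw [e]
      · unfold xPl; omega
      · have := hlit (p / 16 + 1) (!α (p / 16 + 1)); omega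
      · have := hlit (p / 16 + 1) (α (p / 16 + 1)); omega
      · unfold cPl; omega
      · omega)
  refine ⟨g, hg, fun i hi => ?_⟩
  have hg' : ∀ r, r = 0 ∨ r = 1 ∨ 8 ≤ r → r < 16 → (16 * i + r) / 16 = i ∧
      (16 * i + r) % 16 = r ∧ g (16 * i + r) = protoSeat n α Q x o (16 * i + r) := by
    intro r h1 h2
    exact ⟨by omega, by omega, hgf ⟨by omega, by omega⟩⟩
  have hslot : ∀ r, 9 ≤ r → r < 16 →
      (∃ q ∈ Q, x q = i + 1 ∧ 8 + 2 ^ (o q - 1) = r ∧ g (16 * i + r) = cPl n (q + 1)) ∨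
      ((∀ q ∈ Q, x q = i + 1 → 8 + 2 ^ (o q - 1) ≠ r) ∧ g (16 * i + r) = 7 * i + (r - 9)) := by
    intro r h9 h16
    obtain ⟨h1, h2, h3⟩ := hg' r (by omega) h16
    have := hcases (16 * i + r)
    rw [h1, h2, ← h3] at this
    rcases this with ⟨h, e⟩ | ⟨h, e⟩ | ⟨h, e⟩ | h | h
    · omega
    · omega
    · omega
    · exact Or.inl h
    · exact Or.inr h.2
  have hpre : ∀ r, r = 0 ∨ r = 1 ∨ r = 8 → g (16 * i + r) =
      if r = 0 then xPl n (i + 1) else if r = 1 then litPl n (i + 1, !α (i + 1))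
      else litPl n (i + 1, α (i + 1)) := by
    intro r hr
    obtain ⟨h1, h2, h3⟩ := hg' r (by omega) (by omega)
    rw [h3, protoSeat, h1, h2]
    rcases hr with rfl | rfl | rfl <;> simp
  refine ⟨hpre 0 (by simp), hpre 1 (by simp), hpre 8 (by simp), ?_, ?_, ?_⟩
  · intro q hq hxq
    have hp := two_pow_occ (ho q hq).1 (ho q hq).2
    rcases hslot (8 + 2 ^ (o q - 1)) (by omega) (by omega) with ⟨q', hq', hx', h', e⟩ | ⟨h, -⟩
    · rw [e, hxo q' hq' q hq (hx'.trans hxq.symm)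
        (two_pow_occ_inj (ho q' hq').1 (ho q hq).1 (by omega))]
    · exact absurd rfl (h q hq hxq)
  · intro r h9 h16
    rcases hslot r h9 h16 with ⟨q, hq, -, -, e⟩ | ⟨-, e⟩ <;> rw [e]
    · unfold cPl; omega
    · omega
  · intro r hr
    rcases hslot r (by omega) (by omega) with ⟨q, hq, -, h, -⟩ | ⟨-, e⟩
    · have := two_pow_occ (ho q hq).1 (ho q hq).2
      omega
    · omega

end Seating

/-- If the (2,3)-CNF formula `φ` admits an assignment
satisfying at least `k` clauses, then the Construction 1 instance `T_φ` admits
a seeding of tournament value at least `k + n`. -/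
theorem stmt_5 (n k : ℕ) (cs : List Clause2) (hgood : Good23 n cs)
    (α : ℕ → Bool) (hk : k ≤ satCount α cs) :
    ∃ l : List ℕ, IsSeeding (Finset.range (numP n)) l ∧
      ((k : ℤ) + n) ≤ tourValue (gv1 n cs) (Nat.clog 2 (16 * n)) l := by
  have hN := le_numP n
  have hm := two_mul_length_le hgood
  obtain ⟨Q, τ, hQ, hτ⟩ := exists_true_occurrence α cs
  set x : ℕ → ℕ := fun q => ((lits cs).getD (τ q) (0, true)).1
  set o : ℕ → ℕ := fun q => occNum (lits cs) (τ q)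
  have hx : ∀ q ∈ Q, 1 ≤ x q ∧ x q ≤ n := by
    intro q hq
    refine fst_mem_of_mem_lits hgood ?_
    rw [List.getD_eq_getElem _ _ (hτ q hq).2.1]
    exact List.getElem_mem _
  have ho : ∀ q ∈ Q, 1 ≤ o q ∧ o q ≤ 3 := fun q hq =>
    ⟨Nat.le_add_right 1 _, occNum_le_three hgood (hτ q hq).2.1⟩
  have hxo : ∀ q ∈ Q, ∀ q' ∈ Q, x q = x q' → o q = o q' → q = q' := by
    intro q hq q' hq' h h'
    rw [← (hτ q hq).2.2.1, ← (hτ q' hq').2.2.1,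
      eq_of_occNum_eq (hτ q hq).2.1 (hτ q' hq').2.1 h h']
  obtain ⟨g, hg, hgi⟩ := exists_seating (n := n) (α := α) (m := cs.length) (by omega)
    (fun q hq => (hτ q hq).1) ho hxo
  refine ⟨(List.range' 0 (numP n)).map g, isSeeding_map_range' hg, ?_⟩
  have hv := gv1_nonneg n cs
  have hblock : ∀ i < n, 1 + ((Q.filter fun q => x q = i + 1).card : ℤ) ≤
      tourValue (gv1 n cs) 4 ((List.range' (16 * i) (2 ^ 4)).map g) := by
    intro i hi
    obtain ⟨h0, h1, h8, hc, hlt, hlow⟩ := hgi i hi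
    have hlit : numP n - 3 * n ≤ g (16 * i + 8) := by
      rw [h8, litPl_eq]; omega
    have hclause : ∀ j, ∀ q ∈ Q, x q = i + 1 → o q = j →
        gv1 n cs (g (16 * i + 8)) (cPl n (q + 1)) j = 1 := by
      intro j q hq hxq hoq
      refine if_pos (Or.inr (Or.inr ⟨τ q, (hτ q hq).2.1, ?_, ?_, hoq.symm⟩))
      · rw [(hτ q hq).2.2.1]
      · rw [h8, ← hxq]
        exact congrArg (fun b => litPl n (x q, b)) (hτ q hq).2.2.2
    have hround : ∀ j w, (∀ q ∈ Q, x q = i + 1 → o q = j → w = cPl n (q + 1)) →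
        (((Q.filter fun q => x q = i + 1).filter fun q => o q = j).card : ℤ) ≤
          gv1 n cs (g (16 * i + 8)) w j := by
      intro j w hw
      have hle : ((Q.filter fun q => x q = i + 1).filter fun q => o q = j).card ≤ 1 := by
        refine Finset.card_le_one.2 fun a ha b hb => ?_
        simp only [Finset.mem_filter] at ha hb
        exact hxo a ha.1.1 b hb.1.1 (ha.1.2.trans hb.1.2.symm) (ha.2.trans hb.2.symm)
      rcases Finset.eq_empty_or_nonempty
        ((Q.filter fun q => x q = i + 1).filter fun q => o q = j) with he | ⟨q, hq⟩
      · rw [he]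
        exact hv _ _ _
      · simp only [Finset.mem_filter] at hq
        rw [hw q hq.1.1 hq.1.2 hq.2, hclause j q hq.1.1 hq.1.2 hq.2]
        exact_mod_cast hle
    have hcard : (Q.filter fun q => x q = i + 1).card =
        ∑ j ∈ Finset.Icc 1 3, ((Q.filter fun q => x q = i + 1).filter fun q => o q = j).card :=
      Finset.card_eq_sum_card_fiberwise fun q hq => by
        simpa using ho q (Finset.mem_filter.1 hq).1
    have hclow : ∀ q ∈ Q, 7 * n ≤ cPl n (q + 1) := by
      intro q hq
      have := (hτ q hq).1
      unfold cPl
      omega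
    have hgame0 : gv1 n cs (g (16 * i)) (g (16 * i + 1)) 1 = 1 := by
      refine if_pos (Or.inl (Or.inl ⟨i + 1, by omega, by omega, h0, ?_, rfl⟩))
      rw [h1]
      cases α (i + 1) <;> simp [litPl]
    have hgame1 := hround 1 (g (16 * i + 9)) (by
      intro q hq hxq hoq
      simpa [hoq] using hc q hq hxq)
    have hgame2 := hround 2 (winner [g (16 * i + 10), g (16 * i + 11)]) (by
      intro q hq hxq hoq
      have h := hc q hq hxq
      rw [hoq] at h
      rw [← h]
      apply winner_cons_of_forall_le
      have hl := hclow q hq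
      rw [← h] at hl
      simpa using (hlow 11 (by omega)).le.trans hl)
    have hgame3 := hround 3
        (winner [g (16 * i + 12), g (16 * i + 13), g (16 * i + 14), g (16 * i + 15)]) (by
      intro q hq hxq hoq
      have h := hc q hq hxq
      rw [hoq] at h
      rw [← h]
      apply winner_cons_of_forall_le
      have hl := hclow q hq
      rw [← h] at hl
      simpa using ⟨(hlow 13 (by omega)).le.trans hl, (hlow 14 (by omega)).le.trans hl,
        (hlow 15 (by omega)).le.trans hl⟩)
    refine le_trans ?_ (games_le_tourValue_four hv (16 * i) g fun r h9 h16 =>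
      (hlt r h9 h16).le.trans hlit)
    rw [hcard, show Finset.Icc 1 3 = {1, 2, 3} from rfl]
    simp only [Finset.sum_insert, Finset.sum_singleton, Finset.mem_insert, Finset.mem_singleton,
      Nat.reduceEqDiff, OfNat.one_ne_ofNat, or_self, not_false_eq_true, Nat.cast_add]
    linarith
  have hsum : (Q.card : ℤ) = ∑ i ∈ Finset.range n, ((Q.filter fun q => x q = i + 1).card : ℤ) := by
    rw [Finset.card_eq_sum_card_fiberwise (f := fun q => x q - 1) (t := Finset.range n)
      (fun q hq => by have := hx q hq; simp; omega)]
    push_cast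
    refine Finset.sum_congr rfl fun i _ => ?_
    congr 2
    refine Finset.filter_congr fun q hq => ?_
    have := hx q hq
    omega
  rcases Nat.eq_zero_or_pos n with rfl | hn
  · have : Q.card = 0 := by exact_mod_cast hsum
    rw [← hQ, this, Nat.le_zero] at hk
    subst hk
    simpa using tourValue_nonneg hv _ _
  have hclog : 4 ≤ Nat.clog 2 (16 * n) := by
    rw [← Nat.pow_le_pow_iff_right (a := 2) (by norm_num)]
    exact le_trans (by omega) hN
  obtain ⟨d, hd⟩ := Nat.exists_eq_add_of_le hclog
  have hNd : numP n = 2 ^ (4 + d) := by rw [← hd, numP]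
  have hnd : n ≤ 2 ^ d := by
    rw [hNd, pow_add] at hN
    omega
  have htotal := sum_blocks_le_tourValue hv 4 d 0 g
  rw [hd, hNd]
  refine le_trans ?_ htotal
  refine le_trans ?_ (Finset.sum_le_sum_of_subset_of_nonneg (Finset.range_mono hnd)
    fun _ _ _ => tourValue_nonneg hv _ _)
  calc (k : ℤ) + n ≤ Q.card + n := by rw [hQ]; exact_mod_cast Nat.add_le_add_right hk n
    _ = ∑ i ∈ Finset.range n, (1 + ((Q.filter fun q => x q = i + 1).card : ℤ)) := by
      rw [Finset.sum_add_distrib, ← hsum]; simp [add_comm]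
    _ ≤ _ := Finset.sum_le_sum fun i hi => by
      simpa using hblock i (Finset.mem_range.1 hi)
end

section
/- Let φ be a (2,3)-CNF formula with n variables (each clause exactly two literals, each variable in at least 2 and at most 3 clauses), and let T_φ be the Tournament Value Maximization instance obtained from φ by Construction 1. If T_φ admits a tournament seeding whose tournament value is at least k', then φ admits a truth assignment satisfying at least k' − n clauses. -/
/-- The games played in the tournament with `m` rounds on the seeding `l`, as triples
(winner, loser, round). -/
def games : ℕ → List ℕ → List (ℕ × ℕ × ℕ)
  | 0, _ => []
  | m + 1, l =>
      (max (winner (l.take (2 ^ m))) (winner (l.drop (2 ^ m))),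
        min (winner (l.take (2 ^ m))) (winner (l.drop (2 ^ m))), m + 1) ::
      (games m (l.take (2 ^ m)) ++ games m (l.drop (2 ^ m)))

theorem le_winner {l : List ℕ} {a : ℕ} (h : a ∈ l) : a ≤ winner l := by
  induction l with
  | nil => simp at h
  | cons b l ih =>
    simp only [winner, List.foldr_cons] at ih ⊢
    rcases List.mem_cons.1 h with rfl | h
    · exact le_max_left _ _
    · exact (ih h).trans (le_max_right _ _)

theorem winner_mem {l : List ℕ} (h : l ≠ []) : winner l ∈ l := by
  induction l with
  | nil => exact absurd rfl h
  | cons b l ih =>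
    simp only [winner, List.foldr_cons] at ih ⊢
    by_cases hl : l = []
    · simp [hl]
    · rcases max_choice b (l.foldr max 0) with e | e
      · rw [e]
        exact List.mem_cons_self
      · rw [e]
        exact List.mem_cons_of_mem _ (ih hl)

theorem tourValue_eq_sum_games (v : ℕ → ℕ → ℕ → ℤ) (hv : ∀ a b r, v a b r = v b a r) (m : ℕ)
    (l : List ℕ) :
    tourValue v m l = ((games m l).map fun g => v g.1 g.2.1 g.2.2).sum := by
  induction m generalizing l with
  | zero => simp [tourValue, games]
  | succ m ih =>
    simp only [tourValue, games, List.map_cons, List.map_append, List.sum_cons, List.sum_append,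
      ih]
    rcases le_total (winner (l.take (2 ^ m))) (winner (l.drop (2 ^ m))) with h | h
    · rw [max_eq_right h, min_eq_left h, hv]
      ring
    · rw [max_eq_left h, min_eq_right h]
      ring

theorem winner_halves {m : ℕ} {l : List ℕ} (hlen : l.length = 2 ^ (m + 1)) (hnd : l.Nodup) :
    winner (l.take (2 ^ m)) ∈ l.take (2 ^ m) ∧ winner (l.drop (2 ^ m)) ∈ l.drop (2 ^ m) ∧
      (l.take (2 ^ m)).length = 2 ^ m ∧ (l.drop (2 ^ m)).length = 2 ^ m ∧
      ∀ a ∈ l.take (2 ^ m), ∀ b ∈ l.drop (2 ^ m), a ≠ b := by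
  have hpos : 0 < 2 ^ m := by positivity
  rw [pow_succ] at hlen
  have h1 : (l.take (2 ^ m)).length = 2 ^ m := by rw [List.length_take]; omega
  have h2 : (l.drop (2 ^ m)).length = 2 ^ m := by rw [List.length_drop]; omega
  refine ⟨winner_mem ?_, winner_mem ?_, h1, h2, ?_⟩
  · exact List.ne_nil_of_length_pos (by omega)
  · exact List.ne_nil_of_length_pos (by omega)
  · rw [← List.take_append_drop (2 ^ m) l, List.nodup_append] at hnd
    exact hnd.2.2

theorem mem_of_mem_games {m : ℕ} {l : List ℕ} (hlen : l.length = 2 ^ m) (hnd : l.Nodup)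
    {g : ℕ × ℕ × ℕ} (hg : g ∈ games m l) :
    g.1 ∈ l ∧ g.2.1 ∈ l ∧ g.2.1 < g.1 ∧ 1 ≤ g.2.2 ∧ g.2.2 ≤ m := by
  induction m generalizing l with
  | zero => simp [games] at hg
  | succ m ih =>
    obtain ⟨ha, hb, hla, hlb, hne⟩ := winner_halves hlen hnd
    have hna : (l.take (2 ^ m)).Nodup := hnd.sublist (List.take_sublist _ _)
    have hnb : (l.drop (2 ^ m)).Nodup := hnd.sublist (List.drop_sublist _ _)
    have hab := hne _ ha _ hb
    simp only [games, List.mem_cons, List.mem_append] at hg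
    rcases hg with rfl | hg | hg
    · have ha' := List.mem_of_mem_take ha
      have hb' := List.mem_of_mem_drop hb
      dsimp only
      grind
    · have := ih hla hna hg
      have h1 := List.mem_of_mem_take this.1
      have h2 := List.mem_of_mem_take this.2.1
      grind
    · have := ih hlb hnb hg
      have h1 := List.mem_of_mem_drop this.1
      have h2 := List.mem_of_mem_drop this.2.1
      grind

/-- A player wins at most one game per round, loses at most one game, and wins no game in
the round of its defeat or later. -/
theorem games_unique {m : ℕ} {l : List ℕ} (hlen : l.length = 2 ^ m) (hnd : l.Nodup) :
    (games m l).Nodup ∧ ∀ g ∈ games m l, ∀ g' ∈ games m l,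
      (g.1 = g'.1 → g.2.2 = g'.2.2 → g = g') ∧ (g.2.1 = g'.2.1 → g = g') ∧
        (g.2.1 = g'.1 → g'.2.2 < g.2.2) := by
  induction m generalizing l with
  | zero => simp [games]
  | succ m ih =>
    obtain ⟨ha, hb, hla, hlb, hne⟩ := winner_halves hlen hnd
    have hna : (l.take (2 ^ m)).Nodup := hnd.sublist (List.take_sublist _ _)
    have hnb : (l.drop (2 ^ m)).Nodup := hnd.sublist (List.drop_sublist _ _)
    have hab := hne _ ha _ hb
    obtain ⟨na, ua⟩ := ih hla hna
    obtain ⟨nb, ub⟩ := ih hlb hnb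
    have pa := fun g (hg : g ∈ games m (l.take (2 ^ m))) => mem_of_mem_games hla hna hg
    have pb := fun g (hg : g ∈ games m (l.drop (2 ^ m))) => mem_of_mem_games hlb hnb hg
    have wa := fun a (h : a ∈ l.take (2 ^ m)) => le_winner h
    have wb := fun a (h : a ∈ l.drop (2 ^ m)) => le_winner h
    simp only [games]
    generalize l.take (2 ^ m) = A at *
    generalize l.drop (2 ^ m) = B at *
    generalize winner A = a at *
    generalize winner B = b at *
    have hfa : ∀ g ∈ games m A, g.2.1 ≠ max a b ∧ g.2.1 ≠ min a b ∧ g.2.1 ≠ a ∧ g.2.2 ≤ m := by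
      intro g hg
      have h := pa g hg
      have h1 := wa _ h.1
      have h2 := hne _ h.2.1 _ hb
      omega
    have hfb : ∀ g ∈ games m B, g.2.1 ≠ max a b ∧ g.2.1 ≠ min a b ∧ g.2.1 ≠ b ∧ g.2.2 ≤ m := by
      intro g hg
      have h := pb g hg
      have h1 := wb _ h.1
      have h2 := hne _ ha _ h.2.1
      omega
    refine ⟨?_, ?_⟩
    · rw [List.nodup_cons, List.nodup_append, List.mem_append]
      refine ⟨?_, na, nb, ?_⟩
      · rintro (h | h)
        · exact (hfa _ h).2.1 rfl
        · exact (hfb _ h).2.1 rfl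
      · rintro g hg g' hg' rfl
        exact hne _ (pa _ hg).1 _ (pb _ hg').1 rfl
    · have hcross : ∀ g ∈ games m A, ∀ g' ∈ games m B,
          g.1 ≠ g'.1 ∧ g.2.1 ≠ g'.2.1 ∧ g.2.1 ≠ g'.1 ∧ g'.2.1 ≠ g.1 := by
        intro g hg g' hg'
        have h := pa g hg
        have h' := pb g' hg'
        exact ⟨hne _ h.1 _ h'.1, hne _ h.2.1 _ h'.2.1, hne _ h.2.1 _ h'.1,
          (hne _ h.1 _ h'.2.1).symm⟩
      intro g hg g' hg'
      simp only [List.mem_cons, List.mem_append] at hg hg'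
      rcases hg with rfl | hg | hg <;> rcases hg' with rfl | hg' | hg'
      · refine ⟨fun _ _ => rfl, fun _ => rfl, fun h => ?_⟩
        dsimp only at h
        omega
      · have := hfa _ hg'
        refine ⟨fun _ h => ?_, fun h => ?_, fun h => ?_⟩ <;> dsimp only at * <;> omega
      · have := hfb _ hg'
        refine ⟨fun _ h => ?_, fun h => ?_, fun h => ?_⟩ <;> dsimp only at * <;> omega
      · have := hfa _ hg
        refine ⟨fun _ h => ?_, fun h => ?_, fun h => ?_⟩ <;> dsimp only at * <;> omega
      · exact ua g hg g' hg'
      · have := hcross g hg g' hg'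
        exact ⟨fun h => absurd h this.1, fun h => absurd h this.2.1,
          fun h => absurd h this.2.2.1⟩
      · have := hfb _ hg
        refine ⟨fun _ h => ?_, fun h => ?_, fun h => ?_⟩ <;> dsimp only at * <;> omega
      · have := hcross g' hg' g hg
        exact ⟨fun h => absurd h.symm this.1, fun h => absurd h.symm this.2.1,
          fun h => absurd h this.2.2.2⟩
      · exact ub g hg g' hg'

theorem countP_eq_card_filter_range {α : Type*} (p : α → Bool) (d : α) (l : List α) :
    l.countP p = ((Finset.range l.length).filter fun t => p (l.getD t d) = true).card := by
  rw [Finset.card_filter]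
  induction l with
  | nil => simp
  | cons a l ih =>
    rw [List.length_cons, Finset.sum_range_succ', List.countP_cons, ih]
    simp

theorem lits_getD (cs : List Clause2) (d : ℕ × Bool) (e : Clause2) (t : ℕ)
    (ht : t < (lits cs).length) :
    t / 2 < cs.length ∧
      ((lits cs).getD t d = (cs.getD (t / 2) e).1 ∨
        (lits cs).getD t d = (cs.getD (t / 2) e).2) := by
  induction cs generalizing t with
  | nil => simp [lits] at ht
  | cons c cs ih =>
    have hc : lits (c :: cs) = c.1 :: c.2 :: lits cs := rfl
    rw [hc] at ht ⊢
    match t with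
    | 0 => simp
    | 1 => simp
    | t + 2 =>
      have h : (t + 2) / 2 = t / 2 + 1 := by omega
      have := ih t (by simpa using ht)
      simpa [h] using this

theorem Good23.getD_lits_bounds {n : ℕ} {cs : List Clause2} (hgood : Good23 n cs) {t : ℕ}
    (ht : t < (lits cs).length) (d : ℕ × Bool) :
    1 ≤ ((lits cs).getD t d).1 ∧ ((lits cs).getD t d).1 ≤ n := by
  obtain ⟨h, h'⟩ := lits_getD cs d (d, d) t ht
  have hm : cs.getD (t / 2) (d, d) ∈ cs := by
    rw [List.getD_eq_getElem _ _ h]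
    exact List.getElem_mem h
  have := hgood.1 _ hm
  rcases h' with h' | h' <;> rw [h'] <;> omega

theorem gv1_symm (n : ℕ) (cs : List Clause2) (a b r : ℕ) : gv1 n cs a b r = gv1 n cs b a r := by
  unfold gv1
  congr 1
  exact propext or_comm

theorem three_mul_le_numP (n : ℕ) : 3 * n ≤ numP n := by
  have := Nat.le_pow_clog (b := 2) (by norm_num) (16 * n)
  unfold numP
  omega

theorem litPl_var_injective {n : ℕ} {p q : ℕ × Bool} (hp : 1 ≤ p.1 ∧ p.1 ≤ n)
    (hq : 1 ≤ q.1 ∧ q.1 ≤ n) (h : litPl n p = litPl n q) : p.1 = q.1 := by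
  have := three_mul_le_numP n
  unfold litPl xTPl xFPl at h
  split_ifs at h <;> omega

/-- The clause of the `t`-th literal occurrence `p` loses the game `g` against the player of `p`. -/
def IsLitGame (n : ℕ) (cs : List Clause2) (p : ℕ × Bool) (t : ℕ) (g : ℕ × ℕ × ℕ) : Prop :=
  t < (lits cs).length ∧ (lits cs).getD t (0, true) = p ∧
    g.2.1 = cPl n (t / 2 + 1) ∧ g.1 = litPl n p

/-- The player `x_i` wins the game `g` in the first round against `x_i^T` or `x_i^F`. -/
def IsVarGame (n i : ℕ) (g : ℕ × ℕ × ℕ) : Prop :=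
  g.1 = xPl n i ∧ (g.2.1 = litPl n (i, true) ∨ g.2.1 = litPl n (i, false)) ∧ g.2.2 = 1

theorem isVarGame_or_isLitGame {n : ℕ} {cs : List Clause2} (hgood : Good23 n cs)
    {g : ℕ × ℕ × ℕ} (hg : g.2.1 < g.1)
    (h : Gv1Core n cs g.1 g.2.1 g.2.2 ∨ Gv1Core n cs g.2.1 g.1 g.2.2) :
    ∃ i ∈ Finset.Icc 1 n,
      IsVarGame n i g ∨ (∃ t, IsLitGame n cs (i, true) t g) ∨
        ∃ t, IsLitGame n cs (i, false) t g := by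
  rcases h with (⟨i, h1, h2, h3, h4, h5⟩ | ⟨t, h1, h2, h3, -⟩) |
    (⟨i, h1, h2, h3, h4, h5⟩ | ⟨t, h1, h2, h3, -⟩)
  · exact ⟨i, Finset.mem_Icc.2 ⟨h1, h2⟩, Or.inl ⟨h3, by simpa [litPl] using h4, h5⟩⟩
  · exfalso
    have hb := hgood.getD_lits_bounds h1 (0, true)
    rw [h2, h3] at hg
    unfold litPl xTPl xFPl cPl at hg
    split_ifs at hg <;> omega
  · exfalso
    unfold xPl xTPl xFPl at *
    omega
  · have hb := hgood.getD_lits_bounds h1 (0, true)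
    refine ⟨_, Finset.mem_Icc.2 hb, Or.inr ?_⟩
    cases hp : ((lits cs).getD t (0, true)).2
    · have e : (lits cs).getD t (0, true) = (((lits cs).getD t (0, true)).1, false) :=
        Prod.ext rfl hp
      exact Or.inr ⟨t, h1, e, h2, h3.trans (congrArg _ e)⟩
    · have e : (lits cs).getD t (0, true) = (((lits cs).getD t (0, true)).1, true) :=
        Prod.ext rfl hp
      exact Or.inl ⟨t, h1, e, h2, h3.trans (congrArg _ e)⟩

section LitGames

open Classical in
/-- The games of `G` in which the player of the literal `p` defeats a clause containing `p`. -/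
noncomputable def litGames (n : ℕ) (cs : List Clause2) (G : Finset (ℕ × ℕ × ℕ)) (p : ℕ × Bool) :
    Finset (ℕ × ℕ × ℕ) :=
  G.filter fun g => ∃ t, IsLitGame n cs p t g

open Classical in
/-- The games of `G` in which `x_i` defeats `x_i^T` or `x_i^F` in the first round. -/
noncomputable def varGames (n : ℕ) (G : Finset (ℕ × ℕ × ℕ)) (i : ℕ) : Finset (ℕ × ℕ × ℕ) :=
  G.filter (IsVarGame n i)

variable {n : ℕ} {cs : List Clause2} {G : Finset (ℕ × ℕ × ℕ)}

theorem mem_litGames {p : ℕ × Bool} {g : ℕ × ℕ × ℕ} :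
    g ∈ litGames n cs G p ↔ g ∈ G ∧ ∃ t, IsLitGame n cs p t g := by
  classical
  exact Finset.mem_filter

theorem mem_varGames {i : ℕ} {g : ℕ × ℕ × ℕ} :
    g ∈ varGames n G i ↔ g ∈ G ∧ IsVarGame n i g := by
  classical
  exact Finset.mem_filter

theorem card_litGames_le (hlose : ∀ g ∈ G, ∀ g' ∈ G, g.2.1 = g'.2.1 → g = g') (p : ℕ × Bool) :
    (litGames n cs G p).card ≤ (lits cs).countP (· == p) := by
  rw [countP_eq_card_filter_range _ (0, true)]
  refine Finset.card_le_card_of_forall_subsingleton (fun g t => IsLitGame n cs p t g) ?_ ?_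
  · intro g hg
    obtain ⟨t, ht⟩ := (mem_litGames.1 hg).2
    exact ⟨t, by simpa using ⟨ht.1, by simpa using ht.2.1⟩, ht⟩
  · rintro t - g ⟨hg, h⟩ g' ⟨hg', h'⟩
    exact hlose g (mem_litGames.1 hg).1 g' (mem_litGames.1 hg').1
      (h.2.2.1.trans h'.2.2.1.symm)

theorem card_litGames_add_le (hlose : ∀ g ∈ G, ∀ g' ∈ G, g.2.1 = g'.2.1 → g = g') (i : ℕ) :
    (litGames n cs G (i, true)).card + (litGames n cs G (i, false)).card ≤
      (lits cs).countP (fun p => p.1 == i) := by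
  have h : (lits cs).countP (· == (i, true)) + (lits cs).countP (· == (i, false)) =
      (lits cs).countP (fun p => p.1 == i) := by
    induction lits cs with
    | nil => simp
    | cons p L ih =>
      obtain ⟨j, b⟩ := p
      simp only [List.countP_cons, ← ih]
      by_cases hj : j = i <;> cases b <;> simp [hj] <;> omega
  exact h ▸ Nat.add_le_add (card_litGames_le hlose _) (card_litGames_le hlose _)

theorem card_varGames_add_min_le (hgood : Good23 n cs)
    (hwin : ∀ g ∈ G, ∀ g' ∈ G, g.1 = g'.1 → g.2.2 = g'.2.2 → g = g')
    (hlose : ∀ g ∈ G, ∀ g' ∈ G, g.2.1 = g'.2.1 → g = g')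
    (hout : ∀ g ∈ G, ∀ g' ∈ G, g.2.1 = g'.1 → g'.2.2 < g.2.2)
    (hround : ∀ g ∈ G, 1 ≤ g.2.2) {i : ℕ} (hi : i ∈ Finset.Icc 1 n) :
    (varGames n G i).card +
      min (litGames n cs G (i, true)).card (litGames n cs G (i, false)).card ≤ 1 := by
  have hA : (varGames n G i).card ≤ 1 := by
    refine Finset.card_le_one.2 fun g hg g' hg' => ?_
    obtain ⟨hg, h1, -, h3⟩ := mem_varGames.1 hg
    obtain ⟨hg', h1', -, h3'⟩ := mem_varGames.1 hg'
    exact hwin g hg g' hg' (h1.trans h1'.symm) (h3.trans h3'.symm)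
  rcases (varGames n G i).eq_empty_or_nonempty with h0 | ⟨g, hg⟩
  · have h1 := card_litGames_add_le (n := n) (cs := cs) hlose i
    have h2 := (hgood.2 i (Finset.mem_Icc.1 hi).1 (Finset.mem_Icc.1 hi).2).2
    rw [h0, Finset.card_empty]
    omega
  · obtain ⟨hg, -, h2, h3⟩ := mem_varGames.1 hg
    have hB : ∀ b, g.2.1 = litPl n (i, b) → (litGames n cs G (i, b)).card = 0 := by
      intro b hb
      refine Finset.card_eq_zero.2 (Finset.eq_empty_of_forall_notMem fun g' hg' => ?_)
      obtain ⟨hg', t, ht⟩ := mem_litGames.1 hg'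
      have := hout g hg g' hg' (hb.trans ht.2.2.2.symm)
      have := hround g' hg'
      omega
    rcases h2 with h2 | h2 <;> have := hB _ h2 <;> omega

theorem sum_card_litGames_le_satCount
    (hlose : ∀ g ∈ G, ∀ g' ∈ G, g.2.1 = g'.2.1 → g = g') (α : ℕ → Bool) :
    ∑ i ∈ Finset.Icc 1 n, (litGames n cs G (i, α i)).card ≤ satCount α cs := by
  classical
  rw [← Finset.card_biUnion, satCount, countP_eq_card_filter_range _ ((0, true), (0, true))]
  · refine Finset.card_le_card_of_forall_subsingleton
      (fun g j => g ∈ G ∧ g.2.1 = cPl n (j + 1)) ?_ ?_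
    · intro g hg
      obtain ⟨i, -, hg⟩ := Finset.mem_biUnion.1 hg
      obtain ⟨hg, t, h1, h2, h3, -⟩ := mem_litGames.1 hg
      refine ⟨t / 2, ?_, hg, h3⟩
      obtain ⟨h4, h5⟩ := lits_getD cs (0, true) ((0, true), (0, true)) t h1
      refine Finset.mem_filter.2 ⟨Finset.mem_range.2 h4, ?_⟩
      rw [h2] at h5
      rcases h5 with h5 | h5 <;> simp only [clauseSat, ← h5] <;> simp
    · rintro j - g ⟨-, hg, h⟩ g' ⟨-, hg', h'⟩
      exact hlose g hg g' hg' (h.trans h'.symm)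
  · intro i hi j hj hij
    refine Finset.disjoint_left.2 fun g hg hg' => hij ?_
    obtain ⟨-, t, ht⟩ := mem_litGames.1 hg
    obtain ⟨-, t', ht'⟩ := mem_litGames.1 hg'
    exact litPl_var_injective (Finset.mem_Icc.1 hi) (Finset.mem_Icc.1 hj)
      (ht.2.2.2.symm.trans ht'.2.2.2)

theorem sum_gv1_le (hgood : Good23 n cs) (hlt : ∀ g ∈ G, g.2.1 < g.1) :
    ∑ g ∈ G, gv1 n cs g.1 g.2.1 g.2.2 ≤
      ((∑ i ∈ Finset.Icc 1 n, ((varGames n G i).card + (litGames n cs G (i, true)).card +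
        (litGames n cs G (i, false)).card) : ℕ) : ℤ) := by
  classical
  simp only [gv1]
  rw [Finset.sum_boole]
  refine Nat.cast_le.2 (le_trans (Finset.card_le_card (t := (Finset.Icc 1 n).biUnion fun i =>
    varGames n G i ∪ litGames n cs G (i, true) ∪ litGames n cs G (i, false)) ?_) ?_)
  · intro g hg
    obtain ⟨hg, h⟩ := Finset.mem_filter.1 hg
    obtain ⟨i, hi, h⟩ := isVarGame_or_isLitGame hgood (hlt g hg) h
    refine Finset.mem_biUnion.2 ⟨i, hi, ?_⟩
    simp only [mem_varGames, mem_litGames, Finset.mem_union]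
    tauto
  · refine Finset.card_biUnion_le.trans (Finset.sum_le_sum fun i _ => ?_)
    exact (Finset.card_union_le _ _).trans (Nat.add_le_add_right (Finset.card_union_le _ _) _)

end LitGames

/-- If the Construction 1 instance `T_φ` admits a seeding of
tournament value at least `k'`, then the (2,3)-CNF formula `φ` admits an
assignment satisfying at least `k' - n` clauses. -/
theorem stmt_6 (n : ℕ) (cs : List Clause2) (hgood : Good23 n cs)
    (k' : ℤ) (l : List ℕ) (hl : IsSeeding (Finset.range (numP n)) l)
    (hval : k' ≤ tourValue (gv1 n cs) (Nat.clog 2 (16 * n)) l) :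
    ∃ α : ℕ → Bool, k' - n ≤ (satCount α cs : ℤ) := by
  have hlen : l.length = 2 ^ Nat.clog 2 (16 * n) := by
    rw [← List.toFinset_card_of_nodup hl.1, hl.2, Finset.card_range, numP]
  obtain ⟨hnd, hu⟩ := games_unique hlen hl.1
  have hmem := fun g => mem_of_mem_games hlen hl.1 (g := g)
  rw [tourValue_eq_sum_games _ (gv1_symm n cs), ← List.sum_toFinset _ hnd] at hval
  simp only [← List.mem_toFinset] at hu hmem
  generalize (games (Nat.clog 2 (16 * n)) l).toFinset = G at *
  have hlose := fun g hg g' hg' => (hu g hg g' hg').2.1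
  have hvar := fun i (hi : i ∈ Finset.Icc 1 n) => card_varGames_add_min_le hgood
    (fun g hg g' hg' => (hu g hg g' hg').1) hlose (fun g hg g' hg' => (hu g hg g' hg').2.2)
    (fun g hg => (hmem g hg).2.2.2.1) hi
  let α : ℕ → Bool := fun i =>
    decide ((litGames n cs G (i, false)).card < (litGames n cs G (i, true)).card)
  refine ⟨α, ?_⟩
  have hsat := sum_card_litGames_le_satCount (n := n) (cs := cs) hlose α
  have hsum := hval.trans (sum_gv1_le hgood fun g hg => (hmem g hg).2.2.1)
  have hle : ∑ i ∈ Finset.Icc 1 n, ((varGames n G i).card + (litGames n cs G (i, true)).card +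
      (litGames n cs G (i, false)).card) ≤
      ∑ i ∈ Finset.Icc 1 n, (1 + (litGames n cs G (i, α i)).card) := by
    refine Finset.sum_le_sum fun i hi => ?_
    have h := hvar i hi
    by_cases hα : (litGames n cs G (i, false)).card < (litGames n cs G (i, true)).card
    · have : α i = true := decide_eq_true hα
      rw [this]
      omega
    · have : α i = false := decide_eq_false hα
      rw [this]
      omega
  rw [Finset.sum_add_distrib (f := fun _ => 1), Finset.sum_const, Nat.card_Icc, smul_eq_mul, mul_one] at hle
  omega
end

section
/- Let B be a binomial arborescence with vertex set N, where |N| = 2^{n'}, such that for every player i ∈ N and every child j of i in B it holds that i > j. Then there exists a tournament seeding σ for N such that T^{(σ)} = B. -/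
/-- Rooted trees on player labels, in "binomial-merge" form: `leaf u` is the
single-vertex tree on `u`, and `merge t₁ t₂` is the tree obtained from `t₁`
and `t₂` by attaching the root of `t₂` as a new child of the root of `t₁`
(i.e. adding an edge from the root of `t₁` to the root of `t₂`). -/
inductive BTree : Type where
  | leaf : ℕ → BTree
  | merge : BTree → BTree → BTree

namespace BTree

/-- The root of the tree. -/
def root : BTree → ℕ
  | leaf u => u
  | merge t₁ _ => root t₁

/-- The number of vertices of the tree. -/
def size : BTree → ℕ
  | leaf _ => 1
  | merge t₁ t₂ => size t₁ + size t₂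

/-- The list of vertices of the tree. -/
def verts : BTree → List ℕ
  | leaf u => [u]
  | merge t₁ t₂ => verts t₁ ++ verts t₂

end BTree

/-- `t` is a binomial arborescence (BA): a single vertex is a BA, and adding
an edge from the root of a BA `t₁` to the root of a vertex-disjoint BA `t₂` of
equal size yields a BA. -/
inductive IsBA : BTree → Prop where
  | leaf (u : ℕ) : IsBA (BTree.leaf u)
  | merge {t₁ t₂ : BTree} : IsBA t₁ → IsBA t₂ → t₁.size = t₂.size →
      (∀ x ∈ t₁.verts, x ∉ t₂.verts) → IsBA (BTree.merge t₁ t₂)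

/-- The tournament execution tree `T^{(σ)}` of the seeding `l` (with `m`
rounds): its vertices are the players, two players are adjacent iff they play
against each other, and it is rooted at the tournament winner.  Each game
attaches the tree of the knocked-out player as a new child of the winner of
the game (the stronger of the winners of the two halves). -/
def execTree : ℕ → List ℕ → BTree
  | 0, l => BTree.leaf (winner l)
  | m + 1, l =>
      if winner (l.drop (2 ^ m)) < winner (l.take (2 ^ m)) then
        BTree.merge (execTree m (l.take (2 ^ m))) (execTree m (l.drop (2 ^ m)))
      else
        BTree.merge (execTree m (l.drop (2 ^ m))) (execTree m (l.take (2 ^ m)))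

/-- Every parent is stronger than each of its children: in every merge, the
root of the attached tree (the child) is weaker than the root it is attached
to (its parent). -/
def ParentMono : BTree → Prop
  | BTree.leaf _ => True
  | BTree.merge t₁ t₂ => t₂.root < t₁.root ∧ ParentMono t₁ ∧ ParentMono t₂

theorem winner_append (l₁ l₂ : List ℕ) : winner (l₁ ++ l₂) = max (winner l₁) (winner l₂) := by
  induction l₁ with
  | nil => simp [winner]
  | cons a l ih =>
    simp only [winner, List.cons_append, List.foldr_cons] at ih ⊢
    rw [ih, max_assoc]

theorem BTree.length_verts (t : BTree) : t.verts.length = t.size := by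
  induction t with
  | leaf u => rfl
  | merge t₁ t₂ ih₁ ih₂ => simp [BTree.verts, BTree.size, ih₁, ih₂]

theorem ParentMono.winner_verts {t : BTree} (ht : ParentMono t) : winner t.verts = t.root := by
  induction t with
  | leaf u => simp [winner, BTree.verts, BTree.root]
  | merge t₁ t₂ ih₁ ih₂ =>
    obtain ⟨h, h₁, h₂⟩ := ht
    rw [BTree.verts, winner_append, ih₁ h₁, ih₂ h₂, max_eq_left h.le, BTree.root]

theorem IsBA.nodup_verts {t : BTree} (ht : IsBA t) : t.verts.Nodup := by
  induction ht with
  | leaf u => simp [BTree.verts]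
  | merge _ _ _ hdisj ih₁ ih₂ =>
    exact List.Nodup.append ih₁ ih₂ fun x hx hx' => hdisj x hx hx'

theorem BTree.size_pos (t : BTree) : 0 < t.size := by
  induction t with
  | leaf u => exact Nat.one_pos
  | merge t₁ t₂ ih₁ _ => exact Nat.add_pos_left ih₁ _

/-- Seeding the players in the order of the vertex list of a binomial arborescence whose parents
are stronger than their children reproduces that arborescence as the execution tree. -/
theorem IsBA.execTree_verts {t : BTree} (ht : IsBA t) (hmono : ParentMono t) (m : ℕ)
    (hm : t.size = 2 ^ m) : execTree m t.verts = t := by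
  induction ht generalizing m with
  | leaf u =>
    cases m with
    | zero => simp [execTree, winner, BTree.verts]
    | succ m =>
      have := Nat.one_le_two_pow (n := m)
      simp only [BTree.size, pow_succ] at hm
      omega
  | @merge t₁ t₂ _ _ hsize _ ih₁ ih₂ =>
    obtain ⟨h, h₁, h₂⟩ := hmono
    cases m with
    | zero =>
      have := t₁.size_pos
      have := t₂.size_pos
      simp only [BTree.size, pow_zero] at hm
      omega
    | succ m =>
      simp only [BTree.size, pow_succ] at hm
      have hm₁ : t₁.size = 2 ^ m := by omega
      have hm₂ : t₂.size = 2 ^ m := by omega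
      have hlen : t₁.verts.length = 2 ^ m := t₁.length_verts.trans hm₁
      rw [BTree.verts, execTree, List.take_left' hlen, List.drop_left' hlen,
        h₁.winner_verts, h₂.winner_verts, if_pos h, ih₁ h₁ m hm₁, ih₂ h₂ m hm₂]

/-- If `B` is a binomial arborescence with vertex set `N`,
`|N| = 2 ^ n'`, such that every player is stronger than each of its children
in `B`, then there is a tournament seeding `σ` for `N` with `T^{(σ)} = B`. -/
theorem stmt_15 (N : Finset ℕ) (n' : ℕ) (hN : N.card = 2 ^ n')
    (B : BTree) (hBA : IsBA B) (hverts : B.verts.toFinset = N)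
    (hsize : B.size = 2 ^ n') (hmono : ParentMono B) :
    ∃ l : List ℕ, IsSeeding N l ∧ execTree n' l = B := by
  exact ⟨B.verts, ⟨hBA.nodup_verts, hverts⟩, hBA.execTree_verts hmono n' hsize⟩
end
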